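/- Let D = {z ∈ ℝ² : ‖z‖ < 1} (Euclidean norm), S¹ = {θ ∈ ℝ² : ‖θ‖ = 1}, I = {θ ∈ S¹ : θ₁ > 1/2}, Î = {t·θ : θ ∈ I, 0 < t < 1}, and A = {z ∈ D : z₁ > 3/4}. Assume: j : S¹ → S¹ is a homeomorphism such that the sets j^n(I), n ∈ ℤ, are pairwise disjoint; g : [0,1] → [0,1] is a strictly increasing continuous bijection with g(t) > t for all t ∈ (0,1); R : D → D is defined by R(0) = 0 and R(z) = g(‖z‖)·j(z/‖z‖) for z ≠ 0; U is an open set with 0 ∈ U ⊆ {z ∈ ℝ² : ‖z‖ < 3/4}; and F : D → D is a continuous map with F(z) = z whenever z₁ ≤ 1/2, F(D) ⊆ D \ A, F({z ∈ D : z₁ > 1/2}) ⊆ U ∪ Î, and such that for every w ∈ D with 1/2 < w₁ ≤ 3/4 there is z ∈ D with 1/2 < z₁ ≤ 3/4 and F(z) = w. Let f = R ∘ F : D → D. Then the unstable set of the fixed point 0 satisfies W^u_f(0) = D \ ∪_{n≥1} R^n(A). -/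

import Mathlib

open Filter Set Metric

/-- The open unit disk in the plane. -/
noncomputable def diskD : Set (EuclideanSpace ℝ (Fin 2)) :=
  Metric.ball (0 : EuclideanSpace ℝ (Fin 2)) 1

/-- The unit circle in the plane, as a subtype. -/
noncomputable abbrev circleS : Set (EuclideanSpace ℝ (Fin 2)) :=
  Metric.sphere (0 : EuclideanSpace ℝ (Fin 2)) 1

/-- The arc `I = {θ ∈ S¹ : θ₁ > 1/2}` of the circle. -/
noncomputable def arcI : Set circleS :=
  {θ : circleS | (1 : ℝ) / 2 < (θ : EuclideanSpace ℝ (Fin 2)) 0}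

/-- The open angular sector `Î = {t·θ : θ ∈ I, 0 < t < 1}`. -/
noncomputable def sectorI : Set (EuclideanSpace ℝ (Fin 2)) :=
  {z | ∃ θ ∈ arcI, ∃ t : ℝ, 0 < t ∧ t < 1 ∧ z = t • (θ : EuclideanSpace ℝ (Fin 2))}

/-- The region `A = {z ∈ D : z₁ > 3/4}`. -/
noncomputable def regionA : Set (EuclideanSpace ℝ (Fin 2)) :=
  {z ∈ diskD | (3 : ℝ) / 4 < z 0}

/-- The set of endpoints of preorbits in `D` of a map that converge to `0`. -/
def unstableSet {X : Type*} [TopologicalSpace X] [Zero X] (D : Set X) (f : X → X) : Set X :=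
  {y | y ∈ D ∧ ∃ s : ℕ → X, (∀ n, s n ∈ D) ∧ s 0 = y ∧ (∀ n, f (s (n + 1)) = s n) ∧
    Tendsto s atTop (nhds 0)}

theorem unstableSet.map_mem {X : Type*} [TopologicalSpace X] [Zero X] {D : Set X} {f : X → X}
    (hf : MapsTo f D D) {y : X} (hy : y ∈ unstableSet D f) : f y ∈ unstableSet D f := by
  obtain ⟨hyD, s, hsD, hs0, hs, hlim⟩ := hy
  refine ⟨hf hyD, fun n => Nat.casesOn n (f y) s, ?_, rfl, ?_, ?_⟩
  · rintro (_ | n)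
    exacts [hf hyD, hsD n]
  · rintro (_ | n)
    exacts [congrArg f hs0, hs n]
  · exact (tendsto_add_atTop_iff_nat 1).1 hlim

/-- Backward iterates of an expanding continuous map of `[0, 1]` tend to `0`. -/
theorem tendsto_iterate_rightInverse_zero {g h : ℝ → ℝ}
    (hgcont : ContinuousOn g (Icc (0 : ℝ) 1)) (hgexp : ∀ t ∈ Ioo (0 : ℝ) 1, t < g t)
    (hh : MapsTo h (Ico 0 1) (Ico 0 1)) (hgh : ∀ t ∈ Ico (0 : ℝ) 1, g (h t) = t)
    {t : ℝ} (ht : t ∈ Ico (0 : ℝ) 1) :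
    Tendsto (fun n => h^[n] t) atTop (nhds 0) := by
  have hmem : ∀ n, h^[n] t ∈ Ico (0 : ℝ) 1 := fun n => hh.iterate n ht
  have hstep : ∀ n, g (h^[n + 1] t) = h^[n] t := fun n => by
    rw [Function.iterate_succ_apply']
    exact hgh _ (hmem n)
  have hanti : Antitone fun n => h^[n] t := by
    refine antitone_nat_of_succ_le fun n => ?_
    have hn := hstep n
    rcases (hmem (n + 1)).1.eq_or_lt with h0 | h0
    · rw [← h0]
      exact (hmem n).1
    · exact ((hgexp _ ⟨h0, (hmem (n + 1)).2⟩).trans_eq hn).le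
  have hbdd : BddBelow (range fun n => h^[n] t) := ⟨0, by rintro _ ⟨n, rfl⟩; exact (hmem n).1⟩
  have hlim := tendsto_atTop_ciInf hanti hbdd
  set L := ⨅ n, h^[n] t
  have hL0 : 0 ≤ L := ge_of_tendsto' hlim fun n => (hmem n).1
  have hL1 : L < 1 := (ciInf_le hbdd 0).trans_lt ht.2
  have hlim' : Tendsto (fun n => h^[n + 1] t) atTop (nhds L) :=
    (tendsto_add_atTop_iff_nat (f := fun n => h^[n] t) 1).2 hlim
  have hgL : Tendsto (fun n => g (h^[n + 1] t)) atTop (nhds (g L)) :=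
    (hgcont L ⟨hL0, hL1.le⟩).tendsto.comp
      (tendsto_nhdsWithin_iff.2 ⟨hlim', .of_forall fun n => Ico_subset_Icc_self (hmem (n + 1))⟩)
  simp only [hstep] at hgL
  have hfix : L = g L := tendsto_nhds_unique hlim hgL
  rcases hL0.eq_or_lt with h0 | h0
  · rwa [h0]
  · exact absurd hfix (hgexp L ⟨h0, hL1⟩).ne

/-- The orbit of a point visits a wandering set at most once. -/
theorem eq_of_iterate_symm_mem {X : Type*} {e : Equiv.Perm X} {I : Set X}
    (he : ∀ m n : ℤ, m ≠ n → Disjoint (⇑(e ^ m) '' I) (⇑(e ^ n) '' I))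
    {x : X} {m n : ℕ} (hm : e.symm^[m] x ∈ I) (hn : e.symm^[n] x ∈ I) : m = n := by
  by_contra hmn
  have key : ∀ k : ℕ, e.symm^[k] x ∈ I → x ∈ ⇑(e ^ (k : ℤ)) '' I := fun k hk => by
    refine ⟨_, hk, ?_⟩
    rw [zpow_natCast, ← Equiv.Perm.iterate_eq_pow]
    exact Function.LeftInverse.iterate e.apply_symm_apply k x
  exact disjoint_left.1 (he m n (mod_cast hmn)) (key m hm) (key n hn)

theorem norm_smul_circle {t : ℝ} (ht : 0 ≤ t) (θ : circleS) :
    ‖t • (θ : EuclideanSpace ℝ (Fin 2))‖ = t := by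
  rw [norm_smul, mem_sphere_zero_iff_norm.1 θ.2, mul_one, Real.norm_of_nonneg ht]

theorem smul_circle_mem_diskD {t : ℝ} (ht : t ∈ Ico (0 : ℝ) 1) (θ : circleS) :
    t • (θ : EuclideanSpace ℝ (Fin 2)) ∈ diskD := by
  rw [diskD, mem_ball_zero_iff, norm_smul_circle ht.1]
  exact ht.2

theorem exists_polar_of_mem_diskD {z : EuclideanSpace ℝ (Fin 2)} (hz : z ∈ diskD) :
    ∃ t ∈ Ico (0 : ℝ) 1, ∃ θ : circleS, z = t • (θ : EuclideanSpace ℝ (Fin 2)) := by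
  rw [diskD, mem_ball_zero_iff] at hz
  refine ⟨‖z‖, ⟨norm_nonneg z, hz⟩, ?_⟩
  rcases eq_or_ne z 0 with rfl | h0
  · exact ⟨⟨EuclideanSpace.single 0 1, by simp⟩, by simp⟩
  · have hn : ‖z‖ ≠ 0 := norm_ne_zero_iff.2 h0
    refine ⟨⟨‖z‖⁻¹ • z, ?_⟩, ?_⟩
    · rw [mem_sphere_zero_iff_norm, norm_smul, norm_inv, norm_norm, inv_mul_cancel₀ hn]
    · rw [smul_smul, mul_inv_cancel₀ hn, one_smul]

theorem mem_arcI_of_half_lt {t : ℝ} (ht : t ∈ Ico (0 : ℝ) 1) {θ : circleS}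
    (h : 1 / 2 < (t • (θ : EuclideanSpace ℝ (Fin 2))) 0) : θ ∈ arcI := by
  rw [PiLp.smul_apply, smul_eq_mul] at h
  change 1 / 2 < (θ : EuclideanSpace ℝ (Fin 2)) 0
  nlinarith [ht.1, ht.2]

theorem eq_of_smul_circle_eq {s t : ℝ} (hs : 0 < s) (ht : 0 < t) {θ φ : circleS}
    (h : s • (θ : EuclideanSpace ℝ (Fin 2)) = t • (φ : EuclideanSpace ℝ (Fin 2))) :
    s = t ∧ θ = φ := by
  have hst : s = t := by rw [← norm_smul_circle hs.le θ, h, norm_smul_circle ht.le]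
  subst hst
  exact ⟨rfl, Subtype.ext (smul_right_injective _ hs.ne' h)⟩

/-- With `j` a circle homeomorphism for which the arc `I` is
wandering, `g` an increasing bijection of `[0,1]` with `g(t) > t` on `(0,1)`,
`R(z) = g(‖z‖)·j(z/‖z‖)` and `F` a fold-type perturbation supported on
`{z₁ > 1/2}`, the unstable set of the fixed point `0` of `f = R ∘ F` on the
disk `D` equals `D \ ∪_{n≥1} Rⁿ(A)`. -/
theorem unstable_set_of_two_dimensional_example
    (j : circleS ≃ₜ circleS)
    (hj : ∀ m n : ℤ, m ≠ n →
      Disjoint (⇑(j.toEquiv ^ m) '' arcI) (⇑(j.toEquiv ^ n) '' arcI))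
    (g : ℝ → ℝ)
    (hgmono : StrictMonoOn g (Icc (0 : ℝ) 1))
    (hgcont : ContinuousOn g (Icc (0 : ℝ) 1))
    (hgbij : Set.BijOn g (Icc (0 : ℝ) 1) (Icc (0 : ℝ) 1))
    (hgexp : ∀ t ∈ Ioo (0 : ℝ) 1, t < g t)
    (R : EuclideanSpace ℝ (Fin 2) → EuclideanSpace ℝ (Fin 2))
    (hR0 : R 0 = 0)
    (hRD : Set.MapsTo R diskD diskD)
    (hRform : ∀ z : EuclideanSpace ℝ (Fin 2), z ≠ 0 → ‖z‖ < 1 →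
      ∀ hz : ‖z‖⁻¹ • z ∈ circleS,
        R z = g ‖z‖ • ((j ⟨‖z‖⁻¹ • z, hz⟩ : circleS) : EuclideanSpace ℝ (Fin 2)))
    (U : Set (EuclideanSpace ℝ (Fin 2)))
    (hUopen : IsOpen U) (hU0 : (0 : EuclideanSpace ℝ (Fin 2)) ∈ U)
    (hUsmall : U ⊆ {z : EuclideanSpace ℝ (Fin 2) | ‖z‖ < 3 / 4})
    (F : EuclideanSpace ℝ (Fin 2) → EuclideanSpace ℝ (Fin 2))
    (hFcont : ContinuousOn F diskD)
    (hFD : Set.MapsTo F diskD diskD)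
    (hFid : ∀ z ∈ diskD, z 0 ≤ 1 / 2 → F z = z)
    (hFA : F '' diskD ⊆ diskD \ regionA)
    (hFright : F '' {z ∈ diskD | (1 : ℝ) / 2 < z 0} ⊆ U ∪ sectorI)
    (hFsurj : ∀ w ∈ diskD, (1 : ℝ) / 2 < w 0 → w 0 ≤ 3 / 4 →
      ∃ z ∈ diskD, (1 : ℝ) / 2 < z 0 ∧ z 0 ≤ 3 / 4 ∧ F z = w) :
    {y | y ∈ diskD ∧ ∃ s : ℕ → EuclideanSpace ℝ (Fin 2),
      (∀ n : ℕ, s n ∈ diskD) ∧ s 0 = y ∧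
      (∀ n : ℕ, (R ∘ F) (s (n + 1)) = s n) ∧
      Tendsto s atTop (nhds 0)} =
    diskD \ ⋃ (n : ℕ) (_ : 1 ≤ n), R^[n] '' regionA := by
  have hg0 : g 0 = 0 := by
    obtain ⟨x, hx, hx0⟩ := hgbij.surjOn (show (0 : ℝ) ∈ Icc (0 : ℝ) 1 by simp)
    have h1 := hgmono.monotoneOn (show (0 : ℝ) ∈ Icc (0 : ℝ) 1 by simp) hx hx.1
    exact le_antisymm (h1.trans_eq hx0) (hgbij.mapsTo (by simp)).1
  have hg1 : g 1 = 1 := by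
    obtain ⟨x, hx, hx1⟩ := hgbij.surjOn (show (1 : ℝ) ∈ Icc (0 : ℝ) 1 by simp)
    have h1 := hgmono.monotoneOn hx (show (1 : ℝ) ∈ Icc (0 : ℝ) 1 by simp) hx.2
    exact le_antisymm (hgbij.mapsTo (by simp)).2 (hx1.symm.trans_le h1)
  have hgpos : ∀ t, 0 < t → t < 1 → 0 < g t := fun t h0 h1 => h0.trans (hgexp t ⟨h0, h1⟩)
  have hglt : ∀ t, 0 < t → t < 1 → g t < 1 := fun t h0 h1 =>
    (hgmono ⟨h0.le, h1.le⟩ (by simp) h1).trans_eq hg1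
  have hpolar : ∀ t ∈ Ico (0 : ℝ) 1, ∀ θ : circleS,
      R (t • (θ : EuclideanSpace ℝ (Fin 2))) = g t • (j θ : EuclideanSpace ℝ (Fin 2)) := by
    rintro t ⟨ht0, ht1⟩ θ
    rcases ht0.eq_or_lt with rfl | ht0
    · simp [hR0, hg0]
    · have hn := norm_smul_circle ht0.le θ
      have hdir : ‖t • (θ : EuclideanSpace ℝ (Fin 2))‖⁻¹ • t • (θ : EuclideanSpace ℝ (Fin 2))
          = θ := by
        rw [hn, smul_smul, inv_mul_cancel₀ ht0.ne', one_smul]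
      have hne : t • (θ : EuclideanSpace ℝ (Fin 2)) ≠ 0 := by
        rw [← norm_ne_zero_iff, hn]
        exact ht0.ne'
      rw [hRform _ hne (hn.trans_lt ht1) (by rw [hdir]; exact θ.2)]
      congr 3
      exact Subtype.ext hdir
  have hRinj : InjOn R diskD := by
    intro z hz w hw h
    obtain ⟨t, ht, θ, rfl⟩ := exists_polar_of_mem_diskD hz
    obtain ⟨s, hs, φ, rfl⟩ := exists_polar_of_mem_diskD hw
    rw [hpolar t ht, hpolar s hs] at h
    have hgts : g t = g s := by
      rw [← norm_smul_circle (hgbij.mapsTo (Ico_subset_Icc_self ht)).1 (j θ), h,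
        norm_smul_circle (hgbij.mapsTo (Ico_subset_Icc_self hs)).1]
    obtain rfl := hgbij.injOn (Ico_subset_Icc_self ht) (Ico_subset_Icc_self hs) hgts
    rcases ht.1.eq_or_lt with rfl | ht0
    · simp
    · rw [j.injective (eq_of_smul_circle_eq (hgpos t ht0 ht.2) (hgpos t ht0 ht.2) h).2]
  have hfD : MapsTo (R ∘ F) diskD diskD := hRD.comp hFD
  ext y
  constructor
  · rintro ⟨hyD, s, hsD, rfl, hs, -⟩
    refine ⟨hyD, fun hmem => ?_⟩
    simp only [mem_iUnion] at hmem
    obtain ⟨n, hn, a, ⟨haD, ha⟩, has⟩ := hmem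
    obtain ⟨t, ht, θ, rfl⟩ := exists_polar_of_mem_diskD haD
    have hθ : θ ∈ arcI := mem_arcI_of_half_lt ht (by linarith)
    have ht34 : 3 / 4 < t := by
      have h1 := PiLp.norm_apply_le (t • (θ : EuclideanSpace ℝ (Fin 2))) 0
      rw [norm_smul_circle ht.1] at h1
      exact ha.trans_le ((le_abs_self _).trans h1)
    have hiter : ∀ k, ∃ r : ℝ, 3 / 4 < r ∧ r < 1 ∧ R^[k] (t • (θ : EuclideanSpace ℝ (Fin 2))) =
        r • ((j^[k] θ : circleS) : EuclideanSpace ℝ (Fin 2)) := by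
      intro k
      induction k with
      | zero => exact ⟨t, ht34, ht.2, rfl⟩
      | succ k ih =>
        obtain ⟨r, hr, hr1, hk⟩ := ih
        have hr0 : 0 < r := by linarith
        refine ⟨g r, hr.trans (hgexp r ⟨hr0, hr1⟩), hglt r hr0 hr1, ?_⟩
        rw [Function.iterate_succ_apply', Function.iterate_succ_apply', hk, hpolar r ⟨hr0.le, hr1⟩]
    have hcontra : ∀ n m, R^[n + 1] (t • (θ : EuclideanSpace ℝ (Fin 2))) ≠ s m := by
      intro n
      induction n with
      | zero =>
        intro m h
        have h1 := hRinj haD (hFD (hsD (m + 1))) (h.trans (hs m).symm)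
        exact (hFA ⟨_, hsD (m + 1), h1.symm⟩).2 ⟨haD, ha⟩
      | succ n ih =>
        intro m h
        rw [Function.iterate_succ_apply'] at h
        have h1 := hRinj (hRD.iterate (n + 1) haD) (hFD (hsD (m + 1))) (h.trans (hs m).symm)
        rcases le_or_gt (s (m + 1) 0) (1 / 2) with hle | hgt
        · rw [hFid _ (hsD _) hle] at h1
          exact ih (m + 1) h1
        · obtain ⟨r, hr, hr1, hk⟩ := hiter (n + 1)
          have hr0 : 0 < r := by linarith
          rw [hk] at h1
          rcases hFright ⟨_, ⟨hsD (m + 1), hgt⟩, h1.symm⟩ with hU | ⟨φ, hφ, q, hq0, -, hq⟩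
          · have h2 : ‖r • ((j^[n + 1] θ : circleS) : EuclideanSpace ℝ (Fin 2))‖ < 3 / 4 :=
              hUsmall hU
            rw [norm_smul_circle hr0.le] at h2
            linarith
          · have h2 := (eq_of_smul_circle_eq hr0 hq0 hq).2
            have h3 : j.toEquiv.symm^[n + 1] φ ∈ arcI := by
              rw [← h2]
              refine (congrArg (· ∈ arcI) ?_).mpr hθ
              exact Function.LeftInverse.iterate j.symm_apply_apply (n + 1) θ
            exact absurd (eq_of_iterate_symm_mem (m := 0) hj hφ h3) (by simp)
    obtain ⟨n, rfl⟩ := Nat.exists_eq_add_of_le' hn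
    exact hcontra n 0 has
  · rintro ⟨hyD, hy⟩
    change y ∈ unstableSet diskD (R ∘ F)
    obtain ⟨h, hh⟩ : ∃ h : ℝ → ℝ, ∀ t ∈ Ico (0 : ℝ) 1, h t ∈ Ico (0 : ℝ) 1 ∧ g (h t) = t := by
      have : ∀ t : ℝ, ∃ x, t ∈ Ico (0 : ℝ) 1 → x ∈ Ico (0 : ℝ) 1 ∧ g x = t := fun t => by
        by_cases ht : t ∈ Ico (0 : ℝ) 1
        · obtain ⟨x, hx, rfl⟩ := hgbij.surjOn (Ico_subset_Icc_self ht)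
          refine ⟨x, fun _ => ⟨⟨hx.1, hx.2.lt_of_ne ?_⟩, rfl⟩⟩
          rintro rfl
          exact ht.2.ne hg1
        · exact ⟨0, fun h => absurd h ht⟩
      choose h hh using this
      exact ⟨h, hh⟩
    have hmaps : MapsTo h (Ico 0 1) (Ico 0 1) := fun t ht => (hh t ht).1
    let b : ℝ → circleS → ℕ → EuclideanSpace ℝ (Fin 2) := fun t θ n =>
      h^[n] t • ((j.toEquiv.symm^[n] θ : circleS) : EuclideanSpace ℝ (Fin 2))
    have hbD : ∀ t ∈ Ico (0 : ℝ) 1, ∀ θ n, b t θ n ∈ diskD := fun t ht θ n =>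
      smul_circle_mem_diskD (hmaps.iterate n ht) _
    have hbR : ∀ t ∈ Ico (0 : ℝ) 1, ∀ θ n, R (b t θ (n + 1)) = b t θ n := by
      intro t ht θ n
      simp only [b]
      rw [hpolar _ (hmaps.iterate (n + 1) ht), Function.iterate_succ_apply',
        Function.iterate_succ_apply', (hh _ (hmaps.iterate n ht)).2]
      congr 2
      exact j.apply_symm_apply _
    have hbarc : ∀ t ∈ Ico (0 : ℝ) 1, ∀ θ n, 1 / 2 < b t θ n 0 →
        j.toEquiv.symm^[n] θ ∈ arcI := fun t ht θ n hn =>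
      mem_arcI_of_half_lt (hmaps.iterate n ht) hn
    have hW : ∀ t ∈ Ico (0 : ℝ) 1, ∀ θ, (∀ n, b t θ (n + 1) 0 ≤ 1 / 2) →
        b t θ 0 ∈ unstableSet diskD (R ∘ F) := by
      intro t ht θ hle
      refine ⟨hbD t ht θ 0, b t θ, hbD t ht θ, rfl, fun n => ?_, ?_⟩
      · rw [Function.comp_apply, hFid _ (hbD t ht θ _) (hle n), hbR t ht]
      · rw [tendsto_zero_iff_norm_tendsto_zero]
        refine (tendsto_iterate_rightInverse_zero hgcont hgexp hmaps (fun t ht => (hh t ht).2)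
          ht).congr fun n => ?_
        exact (norm_smul_circle (hmaps.iterate n ht).1 _).symm
    obtain ⟨t, ht, θ, rfl⟩ := exists_polar_of_mem_diskD hyD
    change b t θ 0 ∈ _
    by_cases hall : ∀ n, b t θ (n + 1) 0 ≤ 1 / 2
    · exact hW t ht θ hall
    push Not at hall
    obtain ⟨k, hk⟩ := hall
    have hRk : ∀ n, R^[n] (b t θ n) = b t θ 0 := by
      intro n
      induction n with
      | zero => rfl
      | succ n ih => rw [Function.iterate_succ_apply, hbR t ht, ih]
    have hk34 : b t θ (k + 1) 0 ≤ 3 / 4 := by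
      by_contra! hgt
      exact hy (mem_iUnion₂.2 ⟨k + 1, by simp, _, ⟨hbD t ht θ _, hgt⟩, hRk (k + 1)⟩)
    obtain ⟨z, hzD, hz, -, hFz⟩ := hFsurj _ (hbD t ht θ (k + 1)) hk hk34
    obtain ⟨r, hr, φ, rfl⟩ := exists_polar_of_mem_diskD hzD
    have hzW : b r φ 0 ∈ unstableSet diskD (R ∘ F) := by
      refine hW r hr φ fun n => ?_
      by_contra! hn
      exact absurd (eq_of_iterate_symm_mem hj (hbarc r hr φ 0 hz) (hbarc r hr φ _ hn)) (by simp)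
    have hdown : ∀ d i, i + d = k → b t θ i ∈ unstableSet diskD (R ∘ F) := by
      intro d
      induction d with
      | zero =>
        rintro i rfl
        have h1 := unstableSet.map_mem hfD hzW
        rwa [Function.comp_apply, show F (b r φ 0) = _ from hFz, add_zero, hbR t ht] at h1
      | succ d ih =>
        intro i hi
        have h1 := unstableSet.map_mem hfD (ih (i + 1) (by omega))
        have hle : b t θ (i + 1) 0 ≤ 1 / 2 := by
          by_contra! hgt
          have := eq_of_iterate_symm_mem hj (hbarc t ht θ _ hgt) (hbarc t ht θ _ hk)
          omega
        rwa [Function.comp_apply, hFid _ (hbD t ht θ _) hle, hbR t ht] at h1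
    exact hdown k 0 (zero_add k)
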